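/- For every ordered tree with n edges, the number of cycle-labelings of the tree equals the product over non-leaf vertices v of (d(v)-1)!, where d(v) is the number of children of v; consequently the total number of cycle-labeled ordered trees on n edges with outdegree sequence (r_0,...,r_n) is (1/(n+1)) multinomial(n+1; r_0,...,r_n) · Π_{i≥1} ((i-1)!)^{r_i}. -/

import Mathlib

/-- An ordered (plane) rooted tree. -/
inductive OTree where
  | node : List OTree → OTree

/-- Number of edges of an ordered tree. -/
def OTree.edges : OTree → ℕ
  | .node cs => cs.length + (cs.attach.map (fun c => OTree.edges c.1)).sum
  decreasing_by
    have := List.sizeOf_lt_of_mem c.2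
    simp at this ⊢; omega

/-- Number of vertices of an ordered tree having exactly `i` children. -/
def OTree.degCount (i : ℕ) : OTree → ℕ
  | .node cs => (if cs.length = i then 1 else 0) +
      (cs.attach.map (fun c => OTree.degCount i c.1)).sum
  decreasing_by
    have := List.sizeOf_lt_of_mem c.2
    simp at this ⊢; omega

/-- A cycle-labeled ordered tree: each vertex carries a list of labeled child
subtrees (each child edge carries a natural-number label). -/
inductive CTree where
  | node : List (ℕ × CTree) → CTree

/-- Number of edges of a cycle-labeled ordered tree. -/
def CTree.edges : CTree → ℕ
  | .node cs => cs.length + (cs.attach.map (fun c => CTree.edges c.1.2)).sum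
  decreasing_by
    obtain ⟨⟨l, t⟩, hm⟩ := c
    have := List.sizeOf_lt_of_mem hm
    simp at this ⊢; omega

/-- Validity of a cycle-labeling: at each non-leaf vertex with `d` children the
child-edge labels, read left to right, form a permutation of `{1,…,d}` whose
first entry is `d` (a standard cycle). -/
def CTree.valid : CTree → Prop
  | .node cs =>
      (cs ≠ [] → (cs.map Prod.fst).head? = some cs.length ∧
        (cs.map Prod.fst).Perm (List.range' 1 cs.length)) ∧
      ∀ c ∈ cs.attach, CTree.valid c.1.2
  decreasing_by
    obtain ⟨⟨l, t⟩, hm⟩ := c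
    have := List.sizeOf_lt_of_mem hm
    simp at this ⊢; omega

/-- The underlying ordered tree (shape) of a cycle-labeled tree. -/
def CTree.shape : CTree → OTree
  | .node cs => .node (cs.attach.map (fun c => CTree.shape c.1.2))
  decreasing_by
    obtain ⟨⟨l, t⟩, hm⟩ := c
    have := List.sizeOf_lt_of_mem hm
    simp at this ⊢; omega

/-- The product over non-leaf vertices `v` of `(d(v)-1)!`. -/
def OTree.cycProd : OTree → ℕ
  | .node cs => (if cs.isEmpty then 1 else Nat.factorial (cs.length - 1)) *
      (cs.attach.map (fun c => OTree.cycProd c.1)).prod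
  decreasing_by
    have := List.sizeOf_lt_of_mem c.2
    simp at this ⊢; omega

theorem OTree.edges_node (cs : List OTree) :
    (OTree.node cs).edges = cs.length + (cs.map OTree.edges).sum := by
  rw [OTree.edges, List.attach_map_val (f := OTree.edges)]

theorem OTree.degCount_node (i : ℕ) (cs : List OTree) :
    (OTree.node cs).degCount i =
      (if cs.length = i then 1 else 0) + (cs.map (OTree.degCount i)).sum := by
  rw [OTree.degCount, List.attach_map_val (f := OTree.degCount i)]

theorem OTree.cycProd_node (cs : List OTree) :
    (OTree.node cs).cycProd = (cs.length - 1).factorial * (cs.map OTree.cycProd).prod := by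
  rw [OTree.cycProd, List.attach_map_val (f := OTree.cycProd)]
  cases cs <;> simp

theorem CTree.edges_node (cs : List (ℕ × CTree)) :
    (CTree.node cs).edges = cs.length + (cs.map fun c => c.2.edges).sum := by
  rw [CTree.edges, List.attach_map_val (f := fun c : ℕ × CTree => c.2.edges)]

theorem CTree.shape_node (cs : List (ℕ × CTree)) :
    (CTree.node cs).shape = .node (cs.map fun c => c.2.shape) := by
  rw [CTree.shape, List.attach_map_val (f := fun c : ℕ × CTree => c.2.shape)]

theorem CTree.valid_node (cs : List (ℕ × CTree)) :
    (CTree.node cs).valid ↔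
      (cs ≠ [] → (cs.map Prod.fst).head? = some cs.length ∧
        (cs.map Prod.fst).Perm (List.range' 1 cs.length)) ∧ ∀ c ∈ cs, c.2.valid := by
  rw [CTree.valid]
  simp

/-- Induction on ordered trees, with the hypothesis available for every child. -/
theorem OTree.induction_children {P : OTree → Prop}
    (h : ∀ cs : List OTree, (∀ c ∈ cs, P c) → P (.node cs)) : ∀ t, P t
  | .node cs => h cs fun c _ => OTree.induction_children h c

/-- Induction on labeled trees, with the hypothesis available for every child. -/
theorem CTree.induction_children {P : CTree → Prop}
    (h : ∀ cs : List (ℕ × CTree), (∀ c ∈ cs, P c.2) → P (.node cs)) : ∀ t, P t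
  | .node cs => h cs fun c _ => CTree.induction_children h c.2
  decreasing_by
    rename_i hm
    obtain ⟨l, t⟩ := c
    have := List.sizeOf_lt_of_mem hm
    simp at this ⊢; omega

theorem CTree.edges_shape (t : CTree) : t.shape.edges = t.edges := by
  induction t using CTree.induction_children with
  | h cs ih =>
    rw [CTree.shape_node, OTree.edges_node, CTree.edges_node, List.length_map, List.map_map]
    congr 2
    exact List.map_congr_left ih

section Labelings

/-- The admissible sequences of labels on the child edges of a vertex with `d` children. -/
abbrev CycleLabels (d : ℕ) : Type :=
  {l : List ℕ // l.length = d ∧ (d ≠ 0 → l.head? = some d ∧ l.Perm (List.range' 1 d))}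

theorem card_perm_range' (m : ℕ) :
    Nat.card {l : List ℕ // l.Perm (List.range' 1 m)} = m.factorial := by
  have e : {l : List ℕ // l.Perm (List.range' 1 m)} ≃
      {l : List ℕ // l ∈ (List.range' 1 m).permutations.toFinset} :=
    Equiv.subtypeEquivRight fun l => by simp
  rw [Nat.card_congr e, Nat.card_eq_fintype_card, Fintype.card_coe,
    List.toFinset_card_of_nodup (List.nodup_permutations _ List.nodup_range'),
    List.length_permutations, List.length_range']

theorem cons_perm_range'_iff (m : ℕ) (l : List ℕ) :
    ((m + 1) :: l).Perm (List.range' 1 (m + 1)) ↔ l.Perm (List.range' 1 m) := by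
  have h : (List.range' 1 (m + 1)).Perm ((m + 1) :: List.range' 1 m) := by
    rw [List.range'_concat]
    simp [add_comm, List.perm_append_singleton]
  exact ⟨fun hl => (List.perm_cons _).1 (hl.trans h), fun hl => (hl.cons _).trans h.symm⟩

theorem card_cycleLabels (d : ℕ) : Nat.card (CycleLabels d) = (d - 1).factorial := by
  cases d with
  | zero =>
    rw [Nat.card_eq_one_iff_unique.2]
    · rfl
    · refine ⟨⟨fun a b => Subtype.ext ?_⟩, ⟨⟨[], by simp⟩⟩⟩
      rw [List.length_eq_zero_iff.1 a.2.1, List.length_eq_zero_iff.1 b.2.1]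
  | succ m =>
    rw [Nat.add_sub_cancel, ← card_perm_range' m]
    refine (Nat.card_congr (Equiv.ofBijective (fun l : {l : List ℕ // l.Perm (List.range' 1 m)} =>
      (⟨(m + 1) :: l.1, by simpa using l.2.length_eq,
        fun _ => ⟨rfl, (cons_perm_range'_iff m l.1).2 l.2⟩⟩ : CycleLabels (m + 1))) ⟨?_, ?_⟩)).symm
    · intro a b h
      simpa [Subtype.ext_iff] using h
    · rintro ⟨l, hl, h⟩
      obtain ⟨hh, hp⟩ := h m.succ_ne_zero
      cases l with
      | nil => simp at hh
      | cons a l =>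
        obtain rfl : a = m + 1 := by simpa using hh
        exact ⟨⟨l, (cons_perm_range'_iff m l).1 hp⟩, rfl⟩

/-- Lists related entrywise to a fixed list are counted by a product. -/
theorem card_forall₂ {α β : Type*} (R : α → β → Prop) (bs : List β) :
    Nat.card {as : List α // List.Forall₂ R as bs} =
      (bs.map fun b => Nat.card {a : α // R a b}).prod := by
  induction bs with
  | nil =>
    rw [Nat.card_eq_one_iff_unique.2]
    · simp
    · refine ⟨⟨fun a b => Subtype.ext ?_⟩, ⟨⟨[], .nil⟩⟩⟩
      rw [List.forall₂_nil_right_iff.1 a.2, List.forall₂_nil_right_iff.1 b.2]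
  | cons b bs ih =>
    rw [List.map_cons, List.prod_cons, ← ih, ← Nat.card_prod]
    refine (Nat.card_congr (Equiv.ofBijective
      (fun p : {a : α // R a b} × {as : List α // List.Forall₂ R as bs} =>
        (⟨p.1.1 :: p.2.1, .cons p.1.2 p.2.2⟩ :
          {as : List α // List.Forall₂ R as (b :: bs)})) ⟨?_, ?_⟩)).symm
    · rintro ⟨a, as⟩ ⟨a', as'⟩ h
      simpa [Subtype.ext_iff] using h
    · rintro ⟨_, h⟩
      cases h with
      | cons h₁ h₂ => exact ⟨⟨⟨_, h₁⟩, ⟨_, h₂⟩⟩, rfl⟩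

/-- A labeling of a tree is a choice of root labels and of a labeling of each child subtree. -/
theorem card_labelings_node (cs : List OTree) :
    Nat.card {t : CTree // t.valid ∧ t.shape = .node cs} =
      Nat.card (CycleLabels cs.length ×
        {ts : List CTree // List.Forall₂ (fun t c => t.valid ∧ t.shape = c) ts cs}) := by
  have hmem (p : CycleLabels cs.length ×
      {ts : List CTree // List.Forall₂ (fun t c => t.valid ∧ t.shape = c) ts cs}) :
      (CTree.node (p.1.1.zip p.2.1)).valid ∧
        (CTree.node (p.1.1.zip p.2.1)).shape = .node cs := by
    obtain ⟨⟨l, hl, h⟩, ⟨ts, hts⟩⟩ := p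
    have hlen : l.length = ts.length := hl.trans hts.length_eq.symm
    have hfst : (l.zip ts).map Prod.fst = l := List.map_fst_zip hlen.le
    have hsnd : (l.zip ts).map Prod.snd = ts := List.map_snd_zip hlen.ge
    have hzip : (l.zip ts).length = cs.length := by simp [← hlen, hl]
    obtain ⟨hval, hshape⟩ : (∀ t ∈ ts, t.valid) ∧ ts.map CTree.shape = cs := by
      clear hsnd hfst hzip hlen h hl
      induction hts with
      | nil => simp
      | cons h₁ _ ih => simp [h₁.1, h₁.2, ih.2]; exact ih.1
    refine ⟨(CTree.valid_node _).2 ⟨fun hne => ?_, fun c hc => hval _ ?_⟩, ?_⟩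
    · rw [hfst, hzip]
      exact h (hzip ▸ (List.length_pos_iff.2 hne).ne')
    · exact hsnd ▸ List.mem_map_of_mem hc
    · rw [← hsnd, List.map_map] at hshape
      exact (CTree.shape_node _).trans (congrArg OTree.node hshape)
  refine (Nat.card_congr (Equiv.ofBijective (fun p => ⟨.node (p.1.1.zip p.2.1), hmem p⟩)
    ⟨?_, ?_⟩)).symm
  · rintro ⟨⟨l, hl, h⟩, ⟨ts, hts⟩⟩ ⟨⟨l', hl', h'⟩, ⟨ts', hts'⟩⟩ heq
    have hlen : l.length = ts.length := hl.trans hts.length_eq.symm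
    have hlen' : l'.length = ts'.length := hl'.trans hts'.length_eq.symm
    have hz : l.zip ts = l'.zip ts' := CTree.node.inj (Subtype.ext_iff.1 heq)
    have h₁ : l = l' := by
      rw [← List.map_fst_zip hlen.le, hz, List.map_fst_zip hlen'.le]
    have h₂ : ts = ts' := by
      rw [← List.map_snd_zip hlen.ge, hz, List.map_snd_zip hlen'.ge]
    subst h₁ h₂
    rfl
  · rintro ⟨⟨xs⟩, hv, hs⟩
    rw [CTree.shape_node] at hs
    obtain rfl := OTree.node.inj hs
    rw [CTree.valid_node] at hv
    refine ⟨⟨⟨xs.map Prod.fst, by simp, fun hne => ?_⟩, ⟨xs.map Prod.snd, ?_⟩⟩, ?_⟩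
    · have := hv.1 (by rintro rfl; simp at hne)
      simpa using this
    · rw [List.forall₂_map_left_iff, List.forall₂_map_right_iff, List.forall₂_same]
      exact fun x hx => ⟨hv.2 x hx, rfl⟩
    · simp [List.zip_map']

theorem card_labelings (s : OTree) :
    Nat.card {t : CTree // t.valid ∧ t.shape = s} = s.cycProd := by
  induction s using OTree.induction_children with
  | h cs ih =>
    rw [card_labelings_node, Nat.card_prod, card_cycleLabels, card_forall₂, OTree.cycProd_node,
      List.map_congr_left ih]

end Labelings

section Degrees

/-- The multiset of outdegrees of the vertices of an ordered tree. -/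
def OTree.degrees : OTree → Multiset ℕ
  | .node cs => cs.length ::ₘ (cs.attach.map (fun c => OTree.degrees c.1)).sum
  decreasing_by
    have := List.sizeOf_lt_of_mem c.2
    simp at this ⊢; omega

theorem OTree.degrees_node (cs : List OTree) :
    (OTree.node cs).degrees = cs.length ::ₘ (cs.map OTree.degrees).sum := by
  rw [OTree.degrees, List.attach_map_val (f := OTree.degrees)]

theorem OTree.degCount_eq_count (i : ℕ) (t : OTree) : t.degCount i = t.degrees.count i := by
  induction t using OTree.induction_children with
  | h cs ih =>
    rw [OTree.degCount_node, OTree.degrees_node, Multiset.count_cons, List.map_congr_left ih,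
      ← Multiset.coe_countAddMonoidHom, map_list_sum, List.map_map, add_comm]
    simp [eq_comm, Function.comp_def]

theorem OTree.edges_eq_sum (t : OTree) : t.edges = t.degrees.sum := by
  induction t using OTree.induction_children with
  | h cs ih =>
    rw [OTree.edges_node, OTree.degrees_node, Multiset.sum_cons, List.map_congr_left ih,
      ← Multiset.coe_sumAddMonoidHom, map_list_sum, List.map_map]
    rfl

theorem OTree.cycProd_eq_prod (t : OTree) :
    t.cycProd = (t.degrees.map fun d => (d - 1).factorial).prod := by
  induction t using OTree.induction_children with
  | h cs ih =>
    rw [OTree.cycProd_node, OTree.degrees_node, Multiset.map_cons, Multiset.prod_cons,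
      List.map_congr_left ih]
    congr 1
    clear ih
    induction cs with
    | nil => simp
    | cons c cs ih => simp [ih]

theorem OTree.cycProd_pos (t : OTree) : 0 < t.cycProd := by
  rw [OTree.cycProd_eq_prod]
  refine Nat.pos_of_ne_zero (Multiset.prod_ne_zero fun h => ?_)
  obtain ⟨d, -, hd⟩ := Multiset.mem_map.1 h
  exact Nat.factorial_ne_zero _ hd

end Degrees

section Forests

/-- Ordered forests of `k` trees whose vertices have the outdegrees `m`. -/
abbrev Forest (k : ℕ) (m : Multiset ℕ) : Type :=
  {ts : List OTree // ts.length = k ∧ (ts.map OTree.degrees).sum = m}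

/-- Removing the first root, with outdegree `d`, of a forest of `k + 1` trees leaves an arbitrary
forest of `k + d` trees. -/
theorem forest_succ_equiv (k : ℕ) (m : Multiset ℕ) :
    Nonempty (Forest (k + 1) m ≃ Σ d : m.toFinset, Forest (k + d) (m.erase d)) := by
  have hmem (p : Σ d : m.toFinset, Forest (k + d) (m.erase d)) :
      (OTree.node (p.2.1.take p.1) :: p.2.1.drop p.1).length = k + 1 ∧
        ((OTree.node (p.2.1.take p.1) :: p.2.1.drop p.1).map OTree.degrees).sum = m := by
    obtain ⟨⟨d, hd⟩, ⟨ts, hlen, hts⟩⟩ := p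
    refine ⟨by simp [hlen], ?_⟩
    have hd' : d ∈ m := Multiset.mem_toFinset.1 hd
    simp only at hlen hts ⊢
    rw [List.map_cons, List.sum_cons, OTree.degrees_node, Multiset.cons_add, ← List.sum_append,
      ← List.map_append, List.take_append_drop, hts, List.length_take, hlen,
      min_eq_left (Nat.le_add_left d k), Multiset.cons_erase hd']
  refine ⟨(Equiv.ofBijective
    (fun p => ⟨.node (p.2.1.take p.1) :: p.2.1.drop p.1, hmem p⟩) ⟨?_, ?_⟩).symm⟩
  · rintro ⟨⟨d, hd⟩, ⟨ts, hlen, hts⟩⟩ ⟨⟨d', hd'⟩, ⟨ts', hlen', hts'⟩⟩ h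
    have h := Subtype.ext_iff.1 h
    simp only [List.cons.injEq, OTree.node.injEq] at h hlen hlen'
    have hdd : d = d' := by
      have := congrArg List.length h.1
      simpa [hlen, hlen'] using this
    subst hdd
    have : ts = ts' := by
      rw [← List.take_append_drop d ts, h.1, h.2, List.take_append_drop]
    subst this
    rfl
  · rintro ⟨ts, hlen, hts⟩
    cases ts with
    | nil => simp at hlen
    | cons t ts =>
      obtain ⟨cs⟩ := t
      rw [List.map_cons, List.sum_cons, OTree.degrees_node, Multiset.cons_add] at hts
      have hlen' : ts.length = k := by simpa using hlen
      refine ⟨⟨⟨cs.length, ?_⟩, ⟨cs ++ ts, ?_, ?_⟩⟩, ?_⟩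
      · rw [Multiset.mem_toFinset, ← hts]
        exact Multiset.mem_cons_self _ _
      · simp [hlen', add_comm]
      · simp [← hts]
      · simp

theorem card_erase_of_mem_toFinset {m : Multiset ℕ} (d : m.toFinset) {M : ℕ}
    (hm : m.card = M + 1) : (m.erase d).card = M := by
  rw [Multiset.card_erase_of_mem (Multiset.mem_toFinset.1 d.2), hm, Nat.pred_succ]

theorem Forest.finite (M : ℕ) : ∀ (k : ℕ) (m : Multiset ℕ), m.card = M → Finite (Forest k m) := by
  have h₀ (m : Multiset ℕ) : Finite (Forest 0 m) := by
    have : Subsingleton (Forest 0 m) := ⟨fun a b => Subtype.ext <| by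
      rw [List.length_eq_zero_iff.1 a.2.1, List.length_eq_zero_iff.1 b.2.1]⟩
    infer_instance
  induction M with
  | zero =>
    rintro (_ | k) m hm
    · exact h₀ m
    · obtain rfl := Multiset.card_eq_zero.1 hm
      obtain ⟨e⟩ := forest_succ_equiv k 0
      have : IsEmpty (Forest (k + 1) 0) := ⟨fun x => Finset.notMem_empty _ (e x).1.2⟩
      infer_instance
  | succ M ih =>
    rintro (_ | k) m hm
    · exact h₀ m
    · obtain ⟨e⟩ := forest_succ_equiv k m
      have (d : m.toFinset) : Finite (Forest (k + d) (m.erase d)) :=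
        ih _ _ (card_erase_of_mem_toFinset d hm)
      exact Finite.of_equiv _ e.symm

instance (k : ℕ) (m : Multiset ℕ) : Finite (Forest k m) := Forest.finite _ k m rfl

theorem card_forest_succ (k : ℕ) (m : Multiset ℕ) :
    Nat.card (Forest (k + 1) m) = ∑ d ∈ m.toFinset, Nat.card (Forest (k + d) (m.erase d)) := by
  obtain ⟨e⟩ := forest_succ_equiv k m
  rw [Nat.card_congr e, Nat.card_sigma,
    Finset.sum_coe_sort m.toFinset fun d => Nat.card (Forest (k + d) (m.erase d))]

theorem card_forest_zero_zero : Nat.card (Forest 0 0) = 1 :=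
  Nat.card_eq_one_iff_unique.2 ⟨⟨fun a b => Subtype.ext <| by
    rw [List.length_eq_zero_iff.1 a.2.1, List.length_eq_zero_iff.1 b.2.1]⟩, ⟨⟨[], by simp⟩⟩⟩

theorem card_forest_zero {m : Multiset ℕ} (hm : m ≠ 0) : Nat.card (Forest 0 m) = 0 := by
  have : IsEmpty (Forest 0 m) := ⟨fun x => hm <| by
    rw [← x.2.2, List.length_eq_zero_iff.1 x.2.1]; simp⟩
  exact Nat.card_of_isEmpty

/-- The product of the factorials of the multiplicities. -/
def multFactorial (m : Multiset ℕ) : ℕ := ∏ d ∈ m.toFinset, (m.count d).factorial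

theorem multFactorial_eq_prod {m : Multiset ℕ} {s : Finset ℕ} (h : m.toFinset ⊆ s) :
    multFactorial m = ∏ d ∈ s, (m.count d).factorial :=
  Finset.prod_subset h fun d _ hd => by
    rw [Multiset.mem_toFinset] at hd
    rw [Multiset.count_eq_zero_of_notMem hd, Nat.factorial_zero]

theorem multFactorial_erase {m : Multiset ℕ} {d : ℕ} (hd : d ∈ m) :
    multFactorial m = m.count d * multFactorial (m.erase d) := by
  have hd' : d ∈ m.toFinset := Multiset.mem_toFinset.2 hd
  rw [multFactorial_eq_prod (m := m.erase d) (s := m.toFinset)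
      (Multiset.toFinset_subset.2 (Multiset.erase_subset d m)), multFactorial,
    ← Finset.mul_prod_erase _ _ hd', ← Finset.mul_prod_erase _ _ hd', ← mul_assoc,
    Multiset.count_erase_self, Nat.mul_factorial_pred (Multiset.count_pos.2 hd).ne']
  congr 1
  exact Finset.prod_congr rfl fun e he => by
    rw [Multiset.count_erase_of_ne (Finset.ne_of_mem_erase he)]

/-- The number of ordered forests of `k` trees on `M + 1` vertices with given outdegrees. -/
theorem card_forest_mul (M : ℕ) : ∀ (k : ℕ) (m : Multiset ℕ), m.card = M + 1 → m.sum + k = M + 1 →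
    Nat.card (Forest k m) * multFactorial m = k * M.factorial := by
  induction M with
  | zero =>
    intro k m hm hs
    obtain ⟨a, rfl⟩ := Multiset.card_eq_one.1 hm
    rw [Multiset.sum_singleton] at hs
    rcases k with _ | k
    · rw [card_forest_zero (Multiset.singleton_ne_zero a), zero_mul, zero_mul]
    · obtain ⟨rfl, rfl⟩ : a = 0 ∧ k = 0 := by omega
      rw [card_forest_succ]
      simp [multFactorial, card_forest_zero_zero]
  | succ M ih =>
    rintro (_ | k) m hm hs
    · rw [card_forest_zero (by rintro rfl; simp at hm), zero_mul, zero_mul]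
    · have hterm : ∀ d ∈ m.toFinset,
          Nat.card (Forest (k + d) (m.erase d)) * multFactorial m =
            m.count d • ((k + d) * M.factorial) := by
        intro d hd
        have hd' : d ∈ m := Multiset.mem_toFinset.1 hd
        have hsum := Multiset.sum_erase hd'
        rw [multFactorial_erase hd', mul_left_comm,
          ih (k + d) (m.erase d) (card_erase_of_mem_toFinset ⟨d, hd⟩ hm) (by omega), smul_eq_mul]
      rw [card_forest_succ, Finset.sum_mul, Finset.sum_congr rfl hterm,
        ← Finset.sum_multiset_map_count, Multiset.sum_map_mul_right, Multiset.sum_map_add,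
        Multiset.map_const', Multiset.sum_replicate, Multiset.map_id', hm, Nat.factorial_succ,
        ← mul_assoc, smul_eq_mul]
      congr 1
      have : m.sum = M + 1 - k := by omega
      nlinarith

end Forests

/-- Ordered trees with prescribed outdegrees, as one-tree forests. -/
theorem forest_one_equiv (m : Multiset ℕ) :
    Nonempty (Forest 1 m ≃ {s : OTree // s.degrees = m}) := by
  refine ⟨(Equiv.ofBijective (fun s => ⟨[s.1], by simp [s.2]⟩) ⟨?_, ?_⟩).symm⟩
  · intro a b h
    simpa [Subtype.ext_iff] using h
  · rintro ⟨ts, hlen, hts⟩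
    obtain ⟨t, rfl⟩ := List.length_eq_one_iff.1 hlen
    exact ⟨⟨t, by simpa using hts⟩, rfl⟩

/-- Labeled trees with prescribed outdegrees are counted shape by shape. -/
theorem card_labeled_degrees (m : Multiset ℕ) :
    Nat.card {t : CTree // t.valid ∧ t.shape.degrees = m} =
      Nat.card (Forest 1 m) * (m.map fun d => (d - 1).factorial).prod := by
  obtain ⟨e⟩ := forest_one_equiv m
  have : Finite {s : OTree // s.degrees = m} := Finite.of_equiv _ e
  have : Fintype {s : OTree // s.degrees = m} := Fintype.ofFinite _
  have (s : {s : OTree // s.degrees = m}) : Finite {t : CTree // t.valid ∧ t.shape = s.1} :=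
    Nat.finite_of_card_ne_zero (by rw [card_labelings]; exact s.1.cycProd_pos.ne')
  let f : {t : CTree // t.valid ∧ t.shape.degrees = m} ≃
      Σ s : {s : OTree // s.degrees = m}, {t : CTree // t.valid ∧ t.shape = s.1} :=
    { toFun := fun t => ⟨⟨t.1.shape, t.2.2⟩, ⟨t.1, t.2.1, rfl⟩⟩
      invFun := fun p => ⟨p.2.1, p.2.2.1, by rw [p.2.2.2, p.1.2]⟩
      left_inv := fun _ => rfl
      right_inv := by
        rintro ⟨⟨s, hs⟩, ⟨t, ht, hts⟩⟩
        dsimp only at hts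
        subst hts
        rfl }
  rw [Nat.card_congr f, Nat.card_sigma, Nat.card_congr e, Nat.card_eq_fintype_card]
  simp_rw [card_labelings]
  rw [Finset.sum_congr rfl fun s _ => (OTree.cycProd_eq_prod s.1).trans (by rw [s.2]),
    Finset.sum_const, Finset.card_univ, smul_eq_mul]

/-- The multiset containing each `i ≤ n` with multiplicity `r i`. -/
def outdegrees (n : ℕ) (r : ℕ → ℕ) : Multiset ℕ :=
  ∑ i ∈ Finset.range (n + 1), Multiset.replicate (r i) i

theorem count_outdegrees (n : ℕ) (r : ℕ → ℕ) (i : ℕ) :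
    (outdegrees n r).count i = if i ≤ n then r i else 0 := by
  simp [outdegrees, Multiset.count_sum', Multiset.count_replicate]

theorem sum_outdegrees (n : ℕ) (r : ℕ → ℕ) :
    (outdegrees n r).sum = ∑ i ∈ Finset.range (n + 1), i * r i := by
  rw [outdegrees, ← Multiset.coe_sumAddMonoidHom, map_sum]
  simp [mul_comm]

theorem prod_map_outdegrees (n : ℕ) (r : ℕ → ℕ) (f : ℕ → ℕ) :
    ((outdegrees n r).map f).prod = ∏ i ∈ Finset.range (n + 1), f i ^ r i := by
  rw [outdegrees, ← Multiset.coe_mapAddMonoidHom, map_sum, Multiset.prod_sum]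
  simp

theorem multFactorial_outdegrees (n : ℕ) (r : ℕ → ℕ) :
    multFactorial (outdegrees n r) = ∏ i ∈ Finset.range (n + 1), (r i).factorial := by
  rw [multFactorial_eq_prod (s := Finset.range (n + 1))]
  · refine Finset.prod_congr rfl fun i hi => ?_
    rw [count_outdegrees, if_pos (Nat.lt_succ_iff.1 (Finset.mem_range.1 hi))]
  · intro i hi
    rw [Multiset.mem_toFinset, ← Multiset.count_ne_zero, count_outdegrees] at hi
    rw [Finset.mem_range]
    by_contra h
    exact hi (if_neg (by omega))

theorem OTree.degrees_eq_outdegrees_iff {n : ℕ} {r : ℕ → ℕ}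
    (he : ∑ i ∈ Finset.range (n + 1), i * r i = n) (s : OTree) :
    s.degrees = outdegrees n r ↔ s.edges = n ∧ ∀ i ≤ n, s.degCount i = r i := by
  constructor
  · intro h
    refine ⟨by rw [OTree.edges_eq_sum, h, sum_outdegrees, he], fun i hi => ?_⟩
    rw [OTree.degCount_eq_count, h, count_outdegrees, if_pos hi]
  · rintro ⟨hn, hr⟩
    ext i
    rw [count_outdegrees]
    split_ifs with hi
    · rw [← hr i hi, OTree.degCount_eq_count]
    · refine Multiset.count_eq_zero_of_notMem fun hmem => hi ?_
      rw [← hn, OTree.edges_eq_sum]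
      exact Multiset.single_le_sum (fun _ _ => Nat.zero_le _) _ hmem

/-- Each ordered tree has `∏_{v non-leaf} (d(v)-1)!` cycle-labelings, so the
number of cycle-labeled ordered trees with `n` edges and outdegree sequence
`(r₀,…,rₙ)` is `(1/(n+1))·multinomial(n+1; r₀,…,rₙ)·∏_{i≥1} ((i-1)!)^{rᵢ}`. -/
theorem card_cycleLabelings (n : ℕ) (r : ℕ → ℕ)
    (hv : ∑ i ∈ Finset.range (n + 1), r i = n + 1)
    (he : ∑ i ∈ Finset.range (n + 1), i * r i = n) :
    (∀ s : OTree, Nat.card {t : CTree // t.valid ∧ t.shape = s} = s.cycProd) ∧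
      (Nat.card {t : CTree // t.valid ∧ t.edges = n ∧
            ∀ i ≤ n, t.shape.degCount i = r i} : ℚ) =
        (1 / (n + 1 : ℚ)) * Nat.multinomial (Finset.range (n + 1)) r *
          ∏ i ∈ Finset.Icc 1 n, ((Nat.factorial (i - 1) : ℚ)) ^ r i := by
  refine ⟨card_labelings, ?_⟩
  have hcard : (outdegrees n r).card = n + 1 := by
    simp [outdegrees, hv]
  have hforest := card_forest_mul n 1 (outdegrees n r) hcard (by rw [sum_outdegrees, he])
  rw [multFactorial_outdegrees, one_mul] at hforest
  have hmult := Nat.multinomial_spec (Finset.range (n + 1)) r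
  rw [hv, Nat.factorial_succ, ← hforest] at hmult
  have hpos : 0 < ∏ i ∈ Finset.range (n + 1), (r i).factorial :=
    Finset.prod_pos fun i _ => Nat.factorial_pos _
  have hmult' : Nat.multinomial (Finset.range (n + 1)) r =
      (n + 1) * Nat.card (Forest 1 (outdegrees n r)) :=
    Nat.eq_of_mul_eq_mul_left hpos (by rw [hmult]; ring)
  have hprod : ((outdegrees n r).map fun d => (d - 1).factorial).prod =
      ∏ i ∈ Finset.Icc 1 n, (i - 1).factorial ^ r i := by
    rw [prod_map_outdegrees, Finset.prod_range_succ', Finset.range_eq_Ico,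
      Finset.prod_Ico_add' (fun i => (i - 1).factorial ^ r i) 0 n 1]
    simp [Finset.Ico_add_one_right_eq_Icc]
  have hset : Nat.card {t : CTree // t.valid ∧ t.edges = n ∧
      ∀ i ≤ n, t.shape.degCount i = r i} =
        Nat.card {t : CTree // t.valid ∧ t.shape.degrees = outdegrees n r} :=
    Nat.card_congr (Equiv.subtypeEquivRight fun t => by
      rw [OTree.degrees_eq_outdegrees_iff he, CTree.edges_shape])
  rw [hset, card_labeled_degrees, hprod, hmult']
  push_cast
  field_simp
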